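/- arXiv:1810.10815 — 5 statements merged into one kernel-verified Lean document; each statement's English description precedes it below -/
import Mathlib

section
/- Let H be a finite nonempty index set, and for each η ∈ H let x_t^η ∈ X for t = 1,…,T be arbitrary points. Let initial weights w_1^η > 0 satisfy Σ_{η∈H} w_1^η = 1, and define w_{t+1}^η = w_t^η e^{−α f_t(x_t^η)} / Σ_{μ∈H} w_t^μ e^{−α f_t(x_t^μ)} for α > 0, and x_t = Σ_{η∈H} w_t^η x_t^η. Then Σ_{t=1}^T f_t(x_t) − min_{η∈H} ( Σ_{t=1}^T f_t(x_t^η) + (1/α)·ln(1/w_1^η) ) ≤ α T c² / 8. -/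
open Finset

open MeasureTheory ProbabilityTheory in
/-- Hoeffding's lemma for finitely supported distributions. -/
lemma finite_hoeffding {ι : Type*} [Fintype ι] (p g : ι → ℝ) (hp : ∀ i, 0 ≤ p i)
    (hs : ∑ i, p i = 1) (a c : ℝ) (hc : 0 < c) (hg : ∀ i, a ≤ g i ∧ g i ≤ a + c) (s : ℝ) :
    ∑ i, p i * Real.exp (s * g i) ≤ Real.exp (s * ∑ i, p i * g i + s ^ 2 * c ^ 2 / 8) := by
  letI : MeasurableSpace ι := ⊤
  let μ : Measure ι := ∑ i, ENNReal.ofReal (p i) • Measure.dirac i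
  have hint : ∀ h : ι → ℝ, ∫ i, h i ∂μ = ∑ i, p i * h i := by
    intro h
    rw [integral_finset_sum_measure]
    · refine Finset.sum_congr rfl fun i _ => ?_
      rw [integral_smul_measure, integral_dirac, ENNReal.toReal_ofReal (hp i), smul_eq_mul]
    · intro i _
      exact (integrable_dirac (by simp)).smul_measure ENNReal.ofReal_ne_top
  haveI : IsProbabilityMeasure μ := by
    constructor
    simp only [μ, Measure.coe_finset_sum, Finset.sum_apply, Measure.smul_apply, measure_univ,
      smul_eq_mul, mul_one]
    rw [← ENNReal.ofReal_sum_of_nonneg (fun i _ => hp i), hs, ENNReal.ofReal_one]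
  have H := (hasSubgaussianMGF_of_mem_Icc (μ := μ) (X := g) (a := a) (b := a + c)
    (measurable_from_top.aemeasurable) (Filter.Eventually.of_forall fun i => hg i)).mgf_le s
  rw [mgf, hint, hint] at H
  have e1 : ∑ i, p i * Real.exp (s * g i) = Real.exp (s * ∑ i, p i * g i) *
      ∑ i, p i * Real.exp (s * (g i - ∑ i, p i * g i)) := by
    rw [Finset.mul_sum]
    refine Finset.sum_congr rfl fun i _ => ?_
    rw [mul_left_comm, ← Real.exp_add]
    congr 2
    ring
  rw [e1, Real.exp_add]
  refine mul_le_mul_of_nonneg_left (H.trans (le_of_eq ?_)) (Real.exp_pos _).le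
  congr 1
  have : |c| = c := abs_of_pos hc
  simp [this]
  ring

/-- Lemma 1: the exponentially weighted average meta-algorithm with a nonuniform
prior `w_1` over the finite expert set `H` satisfies
`Σ_t f_t(x_t) − min_{η∈H} ( Σ_t f_t(x_t^η) + (1/α)·ln(1/w_1^η) ) ≤ αTc²/8`,
where `x_t = Σ_{η∈H} w_t^η x_t^η` and the losses take values in `[a, a+c]`. -/
theorem meta_algorithm_regret
    {E ι : Type*} [AddCommGroup E] [Module ℝ E] [Fintype ι] [Nonempty ι]
    (X : Set E) (hXconv : Convex ℝ X) (hXne : X.Nonempty)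
    (a c : ℝ) (hc : 0 < c)
    (T : ℕ) (hT : 1 ≤ T)
    (f : ℕ → E → ℝ)
    (hconv : ∀ t ∈ Icc 1 T, ConvexOn ℝ X (f t))
    (hrange : ∀ t ∈ Icc 1 T, ∀ y ∈ X, a ≤ f t y ∧ f t y ≤ a + c)
    (α : ℝ) (hα : 0 < α)
    (xe : ι → ℕ → E) (hxe : ∀ (η : ι), ∀ t ∈ Icc 1 T, xe η t ∈ X)
    (w : ℕ → ι → ℝ)
    (hw1pos : ∀ η : ι, 0 < w 1 η) (hw1sum : ∑ η : ι, w 1 η = 1)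
    (hwup : ∀ (η : ι), ∀ t ∈ Icc 1 T,
      w (t + 1) η = w t η * Real.exp (-α * f t (xe η t)) /
        ∑ μ : ι, w t μ * Real.exp (-α * f t (xe μ t)))
    (x : ℕ → E) (hx : ∀ t ∈ Icc 1 T, x t = ∑ η : ι, w t η • xe η t) :
    ∑ t ∈ Icc 1 T, f t (x t) -
      (Finset.univ.inf' Finset.univ_nonempty fun η : ι =>
        ∑ t ∈ Icc 1 T, f t (xe η t) + (1 / α) * Real.log (1 / w 1 η)) ≤
      α * T * c ^ 2 / 8 := by
  classical
  have key : ∀ n ≤ T, (∀ η, 0 < w (n + 1) η) ∧ ∑ η, w (n + 1) η = 1 ∧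
      ∀ η, α * (∑ t ∈ Icc 1 n, f t (x t)) ≤ α * (∑ t ∈ Icc 1 n, f t (xe η t)) +
        Real.log (w (n + 1) η) - Real.log (w 1 η) + n * (α ^ 2 * c ^ 2 / 8) := by
    intro n
    induction n with
    | zero => intro _; exact ⟨hw1pos, hw1sum, fun η => by simp⟩
    | succ n ih =>
      intro hn
      obtain ⟨hpos, hsum, hb⟩ := ih (by omega)
      have ht : n + 1 ∈ Icc 1 T := by simp; omega
      have hZ : 0 < ∑ μ : ι, w (n + 1) μ * Real.exp (-α * f (n + 1) (xe μ (n + 1))) :=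
        Finset.sum_pos (fun i _ => mul_pos (hpos i) (Real.exp_pos _)) Finset.univ_nonempty
      have hup := fun η => hwup η (n + 1) ht
      refine ⟨fun η => ?_, ?_, fun η => ?_⟩
      · rw [hup η]
        exact div_pos (mul_pos (hpos η) (Real.exp_pos _)) hZ
      · simp_rw [hup]
        rw [← Finset.sum_div, div_self hZ.ne']
      · have hH := finite_hoeffding (w (n + 1)) (fun μ => f (n + 1) (xe μ (n + 1)))
          (fun i => (hpos i).le) hsum a c hc
          (fun i => hrange _ ht _ (hxe i _ ht)) (-α)
        have hL := (Real.log_le_iff_le_exp hZ).2 hH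
        have hJ := (hconv _ ht).map_sum_le (t := Finset.univ) (w := w (n + 1))
          (p := fun η => xe η (n + 1)) (fun i _ => (hpos i).le) hsum (fun i _ => hxe i _ ht)
        rw [← hx _ ht] at hJ
        simp only [smul_eq_mul] at hJ
        have hJ' := mul_le_mul_of_nonneg_left hJ hα.le
        have hlog := congrArg Real.log (hup η)
        rw [Real.log_div (mul_pos (hpos η) (Real.exp_pos _)).ne' hZ.ne',
          Real.log_mul (hpos η).ne' (Real.exp_pos _).ne', Real.log_exp] at hlog
        have := hb η
        rw [Finset.sum_Icc_succ_top (by omega), Finset.sum_Icc_succ_top (by omega)]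
        push_cast
        linarith
  obtain ⟨hpos, hsum, hb⟩ := key T le_rfl
  rw [sub_le_comm]
  refine Finset.le_inf' _ _ fun η _ => ?_
  have h1 : Real.log (w (T + 1) η) ≤ 0 := by
    refine Real.log_nonpos (hpos η).le ?_
    rw [← hsum]
    exact Finset.single_le_sum (fun i _ => (hpos i).le) (Finset.mem_univ η)
  have h2 := hb η
  rw [one_div (w 1 η), Real.log_inv]
  refine le_of_mul_le_mul_left ?_ hα
  have e : α * (∑ t ∈ Icc 1 T, f t (xe η t) + 1 / α * -Real.log (w 1 η)) =
      α * ∑ t ∈ Icc 1 T, f t (xe η t) - Real.log (w 1 η) := by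
    field_simp
    ring
  rw [e]
  linarith
end

section
/- Under the setting of the exponentially weighted average meta-algorithm (weights w_{t+1}^η = w_t^η e^{−α f_t(x_t^η)} / Σ_{μ∈H} w_t^μ e^{−α f_t(x_t^μ)}, output x_t = Σ_{η∈H} w_t^η x_t^η, positive initial weights summing to 1), if the step size is chosen as α = √(8/(T c²)), then for every η ∈ H: Σ_{t=1}^T f_t(x_t) − Σ_{t=1}^T f_t(x_t^η) ≤ (c√(2T)/4)·(1 + ln(1/w_1^η)). -/
open Finset

/-- Hoeffding's lemma for a finite distribution. -/
lemma hoeffding_finite {ι : Type*} [Fintype ι] (w g : ι → ℝ) (hw : ∀ i, 0 < w i)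
    (hs : ∑ i, w i = 1) (a c : ℝ) (hc : 0 < c) (hg : ∀ i, a ≤ g i ∧ g i ≤ a + c) (s : ℝ) :
    ∑ i, w i * Real.exp (s * g i) ≤ Real.exp (s * ∑ i, w i * g i + s ^ 2 * c ^ 2 / 8) := by
  letI : MeasurableSpace ι := ⊤
  let μ : MeasureTheory.Measure ι :=
    ∑ i, ENNReal.ofReal (w i) • MeasureTheory.Measure.dirac i
  have hμ : MeasureTheory.IsProbabilityMeasure μ := by
    constructor
    simp only [μ, MeasureTheory.Measure.coe_finsetSum, Finset.sum_apply,
      MeasureTheory.Measure.smul_apply, MeasureTheory.measure_univ, smul_eq_mul, mul_one]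
    rw [← ENNReal.ofReal_sum_of_nonneg (fun i _ => (hw i).le), hs, ENNReal.ofReal_one]
  have hint : ∀ h : ι → ℝ, ∫ i, h i ∂μ = ∑ i, w i * h i := by
    intro h
    rw [MeasureTheory.integral_finsetSum_measure]
    · refine Finset.sum_congr rfl fun i _ => ?_
      rw [MeasureTheory.integral_smul_measure, MeasureTheory.integral_dirac,
        ENNReal.toReal_ofReal (hw i).le, smul_eq_mul]
    · intro i _
      exact (MeasureTheory.integrable_dirac (by simp)).smul_measure ENNReal.ofReal_ne_top
  have h := ProbabilityTheory.hasSubgaussianMGF_of_mem_Icc (μ := μ) (X := g) (a := a) (b := a + c)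
    (measurable_from_top.aemeasurable) (Filter.Eventually.of_forall hg)
  have h2 := h.mgf_le s
  rw [ProbabilityTheory.mgf, hint, hint] at h2
  have e1 : ∑ i, w i * Real.exp (s * g i) =
      Real.exp (s * ∑ i, w i * g i) * ∑ i, w i * Real.exp (s * (g i - ∑ i, w i * g i)) := by
    rw [Finset.mul_sum]
    refine Finset.sum_congr rfl fun i _ => ?_
    rw [mul_sub, Real.exp_sub]
    field_simp
  rw [e1, Real.exp_add]
  refine mul_le_mul_of_nonneg_left (h2.trans (Real.exp_le_exp.2 ?_)) (Real.exp_pos _).le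
  have : (‖a + c - a‖) = c := by rw [add_sub_cancel_left, Real.norm_of_nonneg hc.le]
  simp only [NNReal.coe_pow, NNReal.coe_div, coe_nnnorm, this, NNReal.coe_ofNat]
  apply le_of_eq
  ring

/-- With the tuned step size `α = √(8/(Tc²))`, the exponentially weighted average
meta-algorithm satisfies, for every expert `η ∈ H`,
`Σ_t f_t(x_t) − Σ_t f_t(x_t^η) ≤ (c√(2T)/4)·(1 + ln(1/w_1^η))`. -/
theorem meta_algorithm_regret_tuned
    {E ι : Type*} [AddCommGroup E] [Module ℝ E] [Fintype ι] [Nonempty ι]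
    (X : Set E) (hXconv : Convex ℝ X) (hXne : X.Nonempty)
    (a c : ℝ) (hc : 0 < c)
    (T : ℕ) (hT : 1 ≤ T)
    (f : ℕ → E → ℝ)
    (hconv : ∀ t ∈ Icc 1 T, ConvexOn ℝ X (f t))
    (hrange : ∀ t ∈ Icc 1 T, ∀ y ∈ X, a ≤ f t y ∧ f t y ≤ a + c)
    (α : ℝ) (hα : α = Real.sqrt (8 / (T * c ^ 2)))
    (xe : ι → ℕ → E) (hxe : ∀ (η : ι), ∀ t ∈ Icc 1 T, xe η t ∈ X)
    (w : ℕ → ι → ℝ)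
    (hw1pos : ∀ η : ι, 0 < w 1 η) (hw1sum : ∑ η : ι, w 1 η = 1)
    (hwup : ∀ (η : ι), ∀ t ∈ Icc 1 T,
      w (t + 1) η = w t η * Real.exp (-α * f t (xe η t)) /
        ∑ μ : ι, w t μ * Real.exp (-α * f t (xe μ t)))
    (x : ℕ → E) (hx : ∀ t ∈ Icc 1 T, x t = ∑ η : ι, w t η • xe η t) :
    ∀ η : ι,
      ∑ t ∈ Icc 1 T, f t (x t) - ∑ t ∈ Icc 1 T, f t (xe η t) ≤
        (c * Real.sqrt (2 * T) / 4) * (1 + Real.log (1 / w 1 η)) := by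
  intro η
  have hTpos : (0 : ℝ) < T := by exact_mod_cast hT
  have hαpos : 0 < α := by rw [hα]; positivity
  have hα2 : α ^ 2 * (T * c ^ 2) = 8 := by
    rw [hα, Real.sq_sqrt (by positivity)]
    field_simp
  have key : ∀ n ≤ T, (∀ i, 0 < w (n + 1) i) ∧ ∑ i, w (n + 1) i = 1 ∧
      α * (∑ t ∈ Icc 1 n, f t (x t) - ∑ t ∈ Icc 1 n, f t (xe η t)) ≤
        n * (α ^ 2 * c ^ 2 / 8) + Real.log (w (n + 1) η) - Real.log (w 1 η) := by
    intro n
    induction n with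
    | zero =>
      intro _
      exact ⟨hw1pos, hw1sum, by simp⟩
    | succ n ih =>
      intro hn
      obtain ⟨hpos, hsum, hreg⟩ := ih (by omega)
      have hmem : n + 1 ∈ Icc 1 T := by simp; omega
      set W := ∑ μ : ι, w (n + 1) μ * Real.exp (-α * f (n + 1) (xe μ (n + 1))) with hW
      have hWpos : 0 < W :=
        Finset.sum_pos (fun i _ => mul_pos (hpos i) (Real.exp_pos _)) Finset.univ_nonempty
      have hup := fun i => hwup i (n + 1) hmem
      refine ⟨fun i => ?_, ?_, ?_⟩
      · rw [hup i]
        exact div_pos (mul_pos (hpos i) (Real.exp_pos _)) hWpos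
      · simp_rw [hup]
        rw [← Finset.sum_div]
        exact div_self hWpos.ne'
      · have hh := hoeffding_finite (w (n + 1)) (fun i => f (n + 1) (xe i (n + 1))) hpos hsum a c hc
          (fun i => hrange _ hmem _ (hxe i _ hmem)) (-α)
        have hlog := (Real.log_le_iff_le_exp hWpos).2 hh
        have hj : f (n + 1) (x (n + 1)) ≤ ∑ i, w (n + 1) i * f (n + 1) (xe i (n + 1)) := by
          rw [hx _ hmem]
          simpa using (hconv _ hmem).map_sum_le (t := Finset.univ) (w := w (n + 1))
            (p := fun i => xe i (n + 1)) (fun i _ => (hpos i).le) hsum (fun i _ => hxe i _ hmem)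
        have hlw : Real.log (w (n + 1 + 1) η) =
            Real.log (w (n + 1) η) + -α * f (n + 1) (xe η (n + 1)) - Real.log W := by
          rw [hup η, Real.log_div (mul_pos (hpos η) (Real.exp_pos _)).ne' hWpos.ne',
            Real.log_mul (hpos η).ne' (Real.exp_pos _).ne', Real.log_exp]
        rw [Finset.sum_Icc_succ_top (by omega), Finset.sum_Icc_succ_top (by omega), hlw]
        have hj2 := mul_le_mul_of_nonneg_left hj hαpos.le
        push_cast
        linarith
  obtain ⟨hpos, hsum, hreg⟩ := key T le_rfl
  have hle : w (T + 1) η ≤ 1 := by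
    rw [← hsum]
    exact Finset.single_le_sum (fun i _ => (hpos i).le) (Finset.mem_univ η)
  have hl0 := Real.log_nonpos (hpos η).le hle
  have hK : α * (c * Real.sqrt (2 * T) / 4) = 1 := by
    have h1 : (α * (c * Real.sqrt (2 * T) / 4)) ^ 2 = 1 := by
      have := Real.sq_sqrt (show (0 : ℝ) ≤ 2 * T by positivity)
      rw [mul_pow, div_pow, mul_pow, this]
      linarith
    have h0 : 0 ≤ α * (c * Real.sqrt (2 * T) / 4) := by positivity
    exact (pow_eq_one_iff_of_nonneg h0 two_ne_zero).1 h1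
  refine le_of_mul_le_mul_left ?_ hαpos
  rw [← mul_assoc, hK, one_div, Real.log_inv]
  linarith
end

section
/- Let D, G > 0, T a positive integer, and P ∈ [0, TD]. Define η*(P) = √((7D² + 4DP)/(2TG²)), N = ⌈(1/2)log₂(1 + 4T/7)⌉ + 1, and k = ⌊(1/2)log₂(1 + 4P/(7D))⌋ + 1. Then 1 ≤ k ≤ N, and the step size η_k = 2^{k−1}(D/G)√(7/(2T)) satisfies η_k ≤ η*(P) ≤ 2η_k. -/
/-- The covering property of the exponentially spaced step-size grid
`η_i = 2^{i−1}(D/G)√(7/(2T))`, `i = 1,…,N`, used by Ader: for every possible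
path-length `P ∈ [0, TD]`, the index `k = ⌊(1/2)log₂(1 + 4P/(7D))⌋ + 1` lies in
`{1,…,N}` and the corresponding step size satisfies `η_k ≤ η*(P) ≤ 2η_k`, where
`η*(P) = √((7D² + 4DP)/(2TG²))`. -/
theorem step_size_grid_covering
    (D G : ℝ) (hD : 0 < D) (hG : 0 < G)
    (T : ℕ) (hT : 1 ≤ T)
    (P : ℝ) (hP0 : 0 ≤ P) (hPT : P ≤ T * D)
    (ηstar : ℝ) (hηstar : ηstar = Real.sqrt ((7 * D ^ 2 + 4 * D * P) / (2 * T * G ^ 2)))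
    (N : ℕ) (hN : N = ⌈(1 / 2 : ℝ) * Real.logb 2 (1 + 4 * T / 7)⌉₊ + 1)
    (k : ℕ) (hk : k = ⌊(1 / 2 : ℝ) * Real.logb 2 (1 + 4 * P / (7 * D))⌋₊ + 1)
    (ηk : ℝ) (hηk : ηk = 2 ^ (k - 1) * (D / G) * Real.sqrt (7 / (2 * T))) :
    1 ≤ k ∧ k ≤ N ∧ ηk ≤ ηstar ∧ ηstar ≤ 2 * ηk := by
  have hT' : (0 : ℝ) < T := by exact_mod_cast hT
  set X : ℝ := 1 + 4 * P / (7 * D) with hX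
  have hX1 : 1 ≤ X := by
    have : 0 ≤ 4 * P / (7 * D) := by positivity
    linarith
  have hX0 : 0 < X := by linarith
  have hXT : X ≤ 1 + 4 * T / 7 := by
    have : 4 * P / (7 * D) ≤ 4 * T / 7 := by
      rw [div_le_div_iff₀ (by positivity) (by norm_num)]
      nlinarith
    linarith
  have hL0 : 0 ≤ Real.logb 2 X := Real.logb_nonneg (by norm_num) hX1
  have hLT : Real.logb 2 X ≤ Real.logb 2 (1 + 4 * T / 7) :=
    Real.logb_le_logb_of_le (by norm_num) hX0 hXT
  set m : ℕ := ⌊(1 / 2 : ℝ) * Real.logb 2 X⌋₊ with hm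
  have hm1 : (m : ℝ) ≤ 1 / 2 * Real.logb 2 X := Nat.floor_le (by positivity)
  have hm2 : 1 / 2 * Real.logb 2 X < (m : ℝ) + 1 := Nat.lt_floor_add_one _
  have hpow : ∀ n : ℕ, ((2 : ℝ) ^ n) ^ 2 = (2 : ℝ) ^ ((2 * n : ℕ) : ℝ) := by
    intro n
    rw [Real.rpow_natCast, ← pow_mul, mul_comm]
  have h1 : (2 : ℝ) ^ m ≤ Real.sqrt X := by
    apply Real.le_sqrt_of_sq_le
    rw [hpow, ← Real.le_logb_iff_rpow_le (by norm_num) hX0]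
    push_cast
    linarith
  have h2 : Real.sqrt X ≤ 2 ^ (m + 1) := by
    apply Real.sqrt_le_iff.mpr
    refine ⟨by positivity, ?_⟩
    rw [hpow, ← Real.logb_le_iff_le_rpow (by norm_num) hX0]
    push_cast
    linarith
  have hstar : ηstar = Real.sqrt X * (D / G) * Real.sqrt (7 / (2 * T)) := by
    have e : (7 * D ^ 2 + 4 * D * P) / (2 * T * G ^ 2)
        = X * (D / G) ^ 2 * (7 / (2 * T)) := by
      rw [hX]
      field_simp
    rw [hηstar, e, Real.sqrt_mul (by positivity), Real.sqrt_mul (by positivity),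
      Real.sqrt_sq (by positivity)]
  have hkm : k - 1 = m := by omega
  rw [hkm] at hηk
  refine ⟨by omega, ?_, ?_, ?_⟩
  · have : m ≤ ⌈(1 / 2 : ℝ) * Real.logb 2 (1 + 4 * T / 7)⌉₊ := by
      have h := Nat.le_ceil ((1 / 2 : ℝ) * Real.logb 2 (1 + 4 * T / 7))
      exact_mod_cast (by linarith :
        (m : ℝ) ≤ (⌈(1 / 2 : ℝ) * Real.logb 2 (1 + 4 * T / 7)⌉₊ : ℝ))
    omega
  · rw [hηk, hstar]
    gcongr
  · rw [hηk, hstar]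
    calc Real.sqrt X * (D / G) * Real.sqrt (7 / (2 * T))
        ≤ 2 ^ (m + 1) * (D / G) * Real.sqrt (7 / (2 * T)) := by gcongr
      _ = 2 * (2 ^ m * (D / G) * Real.sqrt (7 / (2 * T))) := by ring
end

section
/- Let X be a convex subset of a real vector space, f : X → ℝ a convex function with a ≤ f(x) ≤ a + c for all x ∈ X (a ∈ ℝ, c > 0), and α > 0. Let x_1,…,x_n ∈ X and let w_1,…,w_n ≥ 0 with Σ_{i=1}^n w_i = 1. Then ln( Σ_{i=1}^n w_i e^{−α f(x_i)} ) ≤ −α f( Σ_{i=1}^n w_i x_i ) + α² c² / 8. -/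
open Finset

open MeasureTheory ProbabilityTheory in
theorem hoeffding_aux (n : ℕ) (w g : Fin n → ℝ) (hw : ∀ i, 0 ≤ w i) (hwsum : ∑ i, w i = 1)
    (a c : ℝ) (hg : ∀ i, a ≤ g i ∧ g i ≤ a + c) (t : ℝ) :
    ∑ i, w i * Real.exp (t * (g i - ∑ j, w j * g j)) ≤ Real.exp (t ^ 2 * c ^ 2 / 8) := by
  let μ : Measure (Fin n) := ∑ i, ENNReal.ofReal (w i) • Measure.dirac i
  have hint : ∀ F : Fin n → ℝ, ∫ i, F i ∂μ = ∑ i, w i * F i := by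
    intro F
    simp only [μ]
    rw [integral_finset_sum_measure]
    · refine Finset.sum_congr rfl fun i _ => ?_
      rw [integral_smul_measure, integral_dirac, ENNReal.toReal_ofReal (hw i), smul_eq_mul]
    · intro i _
      exact (integrable_dirac (by simp)).smul_measure ENNReal.ofReal_ne_top
  have hp : IsProbabilityMeasure μ := by
    constructor
    simp only [μ, Measure.finset_sum_apply, Measure.smul_apply, measure_univ, smul_eq_mul, mul_one]
    rw [← ENNReal.ofReal_sum_of_nonneg (fun i _ => hw i), hwsum, ENNReal.ofReal_one]
  have key := (hasSubgaussianMGF_of_mem_Icc (μ := μ) (X := g) (a := a) (b := a + c)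
    (measurable_of_finite g).aemeasurable (Filter.Eventually.of_forall hg)).mgf_le t
  rw [mgf, hint, hint] at key
  refine key.trans (le_of_eq ?_)
  congr 1
  have : |c| ^ 2 = c ^ 2 := sq_abs c
  simp only [NNReal.coe_pow, NNReal.coe_div, coe_nnnorm, Real.norm_eq_abs, add_sub_cancel_left,
    NNReal.coe_ofNat, div_pow, this]
  ring

/-- Hoeffding's lemma combined with Jensen's inequality, as used in the proof of
Lemma 1: for a convex function `f` with values in `[a, a+c]` on the convex set
`X`, points `x_i ∈ X` and weights `w_i ≥ 0` summing to `1`,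
`ln( Σ_i w_i e^{−α f(x_i)} ) ≤ −α f( Σ_i w_i x_i ) + α²c²/8`. -/
theorem hoeffding_jensen_mix_loss
    {E : Type*} [AddCommGroup E] [Module ℝ E]
    (X : Set E) (hXconv : Convex ℝ X)
    (f : E → ℝ) (hf : ConvexOn ℝ X f)
    (a c : ℝ) (hc : 0 < c)
    (hrange : ∀ x ∈ X, a ≤ f x ∧ f x ≤ a + c)
    (α : ℝ) (hα : 0 < α)
    (n : ℕ) (x : Fin n → E) (hx : ∀ i, x i ∈ X)
    (w : Fin n → ℝ) (hw : ∀ i, 0 ≤ w i) (hwsum : ∑ i, w i = 1) :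
    Real.log (∑ i, w i * Real.exp (-α * f (x i))) ≤
      -α * f (∑ i, w i • x i) + α ^ 2 * c ^ 2 / 8 := by
  have hJ : f (∑ i, w i • x i) ≤ ∑ i, w i * f (x i) := by
    simpa using hf.map_sum_le (t := Finset.univ) (fun i _ => hw i) hwsum (fun i _ => hx i)
  have hH := hoeffding_aux n w (fun i => f (x i)) hw hwsum a c (fun i => hrange _ (hx i)) (-α)
  set m := ∑ i, w i * f (x i) with hm
  have hS : ∑ i, w i * Real.exp (-α * f (x i))
      = Real.exp (-α * m) * ∑ i, w i * Real.exp (-α * (f (x i) - m)) := by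
    rw [Finset.mul_sum]
    refine Finset.sum_congr rfl fun i _ => ?_
    rw [mul_left_comm, ← Real.exp_add]
    congr 2
    ring
  have hpos : 0 < ∑ i, w i * Real.exp (-α * f (x i)) := by
    have h0 : ∀ i ∈ Finset.univ, 0 ≤ w i * Real.exp (-α * f (x i)) :=
      fun i _ => mul_nonneg (hw i) (Real.exp_pos _).le
    obtain ⟨i, -, hi⟩ : ∃ i ∈ (Finset.univ : Finset (Fin n)), 0 < w i := by
      apply Finset.exists_lt_of_sum_lt
      simp [hwsum]
    exact Finset.sum_pos' h0 ⟨i, Finset.mem_univ i, mul_pos hi (Real.exp_pos _)⟩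
  rw [Real.log_le_iff_le_exp hpos, hS]
  calc _ ≤ Real.exp (-α * m) * Real.exp ((-α) ^ 2 * c ^ 2 / 8) := by gcongr
    _ = Real.exp (-α * m + α ^ 2 * c ^ 2 / 8) := by rw [← Real.exp_add, neg_sq]
    _ ≤ _ := by
      apply Real.exp_le_exp.mpr
      nlinarith
end

section
/- Let D, G > 0, T a positive integer, and P' ∈ [0, TD]. Define η*(P') = √((D² + 2DP')/(TG²)), N = ⌈(1/2)log₂(1 + 2T)⌉ + 1, and k = ⌊(1/2)log₂(1 + 2P'/D)⌋ + 1. Then 1 ≤ k ≤ N, and the step size η_k = 2^{k−1}(D/G)√(1/T) satisfies η_k ≤ η*(P') ≤ 2η_k. -/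
/-- The covering property of the step-size grid `η_i = 2^{i−1}(D/G)√(1/T)`,
`i = 1,…,N`, used by Ader with dynamical models: for every possible value
`P' ∈ [0, TD]` of the regularity, the index `k = ⌊(1/2)log₂(1 + 2P'/D)⌋ + 1`
lies in `{1,…,N}` and the corresponding step size satisfies
`η_k ≤ η*(P') ≤ 2η_k`, where `η*(P') = √((D² + 2DP')/(TG²))`. -/
theorem step_size_grid_covering_dynamics
    (D G : ℝ) (hD : 0 < D) (hG : 0 < G)
    (T : ℕ) (hT : 1 ≤ T)
    (P' : ℝ) (hP0 : 0 ≤ P') (hPT : P' ≤ T * D)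
    (ηstar : ℝ) (hηstar : ηstar = Real.sqrt ((D ^ 2 + 2 * D * P') / (T * G ^ 2)))
    (N : ℕ) (hN : N = ⌈(1 / 2 : ℝ) * Real.logb 2 (1 + 2 * T)⌉₊ + 1)
    (k : ℕ) (hk : k = ⌊(1 / 2 : ℝ) * Real.logb 2 (1 + 2 * P' / D)⌋₊ + 1)
    (ηk : ℝ) (hηk : ηk = 2 ^ (k - 1) * (D / G) * Real.sqrt (1 / T)) :
    1 ≤ k ∧ k ≤ N ∧ ηk ≤ ηstar ∧ ηstar ≤ 2 * ηk := by
  have hT' : (0 : ℝ) < T := by exact_mod_cast hT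
  have hx1 : 1 ≤ 1 + 2 * P' / D := by
    have : 0 ≤ 2 * P' / D := by positivity
    linarith
  have hxT : 1 + 2 * P' / D ≤ 1 + 2 * T := by
    have : 2 * P' / D ≤ 2 * T := by
      rw [div_le_iff₀ hD]
      linarith
    linarith
  have hstar : ηstar = Real.sqrt (1 + 2 * P' / D) * (D / G) * Real.sqrt (1 / T) := by
    have h : (D ^ 2 + 2 * D * P') / (T * G ^ 2)
        = (1 + 2 * P' / D) * (D / G) ^ 2 * (1 / T) := by
      field_simp
    rw [hηstar, h, Real.sqrt_mul (by positivity), Real.sqrt_mul (by linarith),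
      Real.sqrt_sq (by positivity)]
  generalize 1 + 2 * P' / D = x at *
  have hx0 : 0 < x := by linarith
  have hL : 0 ≤ (1 / 2 : ℝ) * Real.logb 2 x :=
    mul_nonneg (by norm_num) (Real.logb_nonneg (by norm_num) hx1)
  have hle := Nat.floor_le hL
  have hlt := Nat.lt_floor_add_one ((1 / 2 : ℝ) * Real.logb 2 x)
  have hmN : ⌊(1 / 2 : ℝ) * Real.logb 2 x⌋₊ ≤ ⌈(1 / 2 : ℝ) * Real.logb 2 (1 + 2 * T)⌉₊ := by
    refine (Nat.floor_le_ceil _).trans (Nat.ceil_mono ?_)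
    have := Real.logb_le_logb_of_le (b := 2) (by norm_num) hx0 hxT
    linarith
  generalize ⌊(1 / 2 : ℝ) * Real.logb 2 x⌋₊ = m at *
  have h1 : (2 : ℝ) ^ m ≤ Real.sqrt x := by
    apply Real.le_sqrt_of_sq_le
    have h : ((2 * m : ℕ) : ℝ) ≤ Real.logb 2 x := by push_cast; linarith
    rw [Real.le_logb_iff_rpow_le (by norm_num) hx0, Real.rpow_natCast] at h
    rwa [← pow_mul, mul_comm]
  have h2 : Real.sqrt x ≤ 2 * (2 : ℝ) ^ m := by
    apply Real.sqrt_le_iff.mpr ⟨by positivity, ?_⟩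
    have h : Real.logb 2 x ≤ ((2 * (m + 1) : ℕ) : ℝ) := by push_cast; linarith
    rw [Real.logb_le_iff_le_rpow (by norm_num) hx0, Real.rpow_natCast] at h
    rwa [← pow_succ', ← pow_mul, mul_comm]
  subst hk hN
  rw [Nat.add_sub_cancel] at hηk
  refine ⟨by omega, by omega, ?_, ?_⟩
  · rw [hηk, hstar]
    gcongr
  · rw [hηk, hstar]
    calc _ ≤ 2 * (2 : ℝ) ^ m * (D / G) * Real.sqrt (1 / T) := by gcongr
      _ = _ := by ring
end
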